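/- arXiv:2107.11051 — 4 statements merged into one kernel-verified Lean document; each statement's English description precedes it below -/
import Mathlib

section
/- Let X and M be finite-dimensional real inner product spaces, a : X × X → ℝ a symmetric positive definite bilinear form, and b : X × M → ℝ a bilinear form satisfying the inf-sup condition: there is β₀ > 0 such that for every q ∈ M, sup_{0≠v∈X} b(v,q)/a(v,v)^{1/2} ≥ β₀‖q‖_M. Let V = {v ∈ X : b(v,q) = 0 for all q ∈ M}, let V^⊥ be the orthogonal complement of V in X with respect to ⟪·,·⟫_X, and let −Δ_X : X → X be the (invertible) linear map defined by ⟪−Δ_X z, v⟫_X = a(z,v) for all v ∈ X. Then for every w ∈ V^⊥ there exists a unique p ∈ M such that ⟪w, v⟫_X = b(v, p) for all v ∈ X, and this p satisfies ‖p‖_M ≤ β₀⁻¹ · a((−Δ_X)⁻¹w, (−Δ_X)⁻¹w)^{1/2}. -/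
open scoped RealInnerProductSpace

/-- If `b` is bounded below in the inf-sup sense and `b (·) q` is dominated by `C` times the energy
norm, then `q` is bounded by `C`. -/
theorem norm_le_of_infSup {X M : Type*} [AddCommGroup X] [Module ℝ X]
    [NormedAddCommGroup M] [Module ℝ M]
    {a : X →ₗ[ℝ] X →ₗ[ℝ] ℝ} {b : X →ₗ[ℝ] M →ₗ[ℝ] ℝ}
    (ha : ∀ v : X, v ≠ 0 → 0 < a v v) {β C : ℝ} (hβ : 0 < β) (hC : 0 ≤ C) {q : M}
    (hq : β * ‖q‖ ≤ ⨆ v : {v : X // v ≠ 0}, b (v : X) q / √(a (v : X) (v : X)))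
    (hb : ∀ v : X, b v q ≤ C * √(a v v)) : ‖q‖ ≤ β⁻¹ * C := by
  rw [le_inv_mul_iff₀ hβ]
  refine hq.trans (Real.iSup_le (fun v => ?_) hC)
  rw [div_le_iff₀ (Real.sqrt_pos.2 (ha v v.2))]
  exact hb v

/-- A functional vanishing on the common kernel of the functionals `b (·) q` is one of them. -/
theorem exists_eq_flip_apply {K X M : Type*} [Field K] [AddCommGroup X] [Module K X]
    [FiniteDimensional K X] [AddCommGroup M] [Module K M]
    (b : X →ₗ[K] M →ₗ[K] K) (φ : Module.Dual K X)
    (hφ : ∀ v : X, (∀ q : M, b v q = 0) → φ v = 0) : ∃ p : M, ∀ v : X, φ v = b v p := by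
  have hmem : φ ∈ LinearMap.range b.flip := by
    rw [← Subspace.dualCoannihilator_dualAnnihilator_eq (W := LinearMap.range b.flip),
      Submodule.mem_dualAnnihilator]
    intro v hv
    rw [Submodule.mem_dualCoannihilator] at hv
    exact hφ v fun q => hv _ ⟨q, rfl⟩
  obtain ⟨p, rfl⟩ := hmem
  exact ⟨p, fun v => rfl⟩

/-- **Existence and uniqueness of the discrete pressure (Lemma 3.1), abstract form.**
`X` and `M` are finite-dimensional real inner product spaces, `a` a symmetric positive definite
bilinear form on `X`, and `b : X × M → ℝ` a bilinear form satisfying the inf-sup condition with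
constant `β₀ > 0`.  `V = {v : b(v, ·) = 0}`, and `L` represents `-Δ_X`, i.e.
`⟪L z, v⟫ = a(z, v)` for all `v`.  Then every `w ∈ V^⊥` is represented by a unique pressure
`p ∈ M` via `⟪w, v⟫ = b(v, p)` for all `v ∈ X`, and any such `p` satisfies
`‖p‖ ≤ β₀⁻¹ √(a((-Δ_X)⁻¹ w, (-Δ_X)⁻¹ w))`. -/
theorem stmt3 (X Mp : Type)
    [NormedAddCommGroup X] [InnerProductSpace ℝ X] [FiniteDimensional ℝ X]
    [NormedAddCommGroup Mp] [InnerProductSpace ℝ Mp] [FiniteDimensional ℝ Mp]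
    (a : X →ₗ[ℝ] X →ₗ[ℝ] ℝ) (b : X →ₗ[ℝ] Mp →ₗ[ℝ] ℝ)
    (hasymm : ∀ u v : X, a u v = a v u)
    (hapos : ∀ v : X, v ≠ 0 → 0 < a v v)
    (β₀ : ℝ) (hβ₀ : 0 < β₀)
    (hinfsup : ∀ q : Mp,
      β₀ * ‖q‖ ≤ ⨆ v : {v : X // v ≠ 0}, b (v : X) q / Real.sqrt (a (v : X) (v : X)))
    (L : X →ₗ[ℝ] X) (hL : ∀ z v : X, ⟪L z, v⟫ = a z v) :
    ∀ w : X, (∀ v : X, (∀ q : Mp, b v q = 0) → ⟪w, v⟫ = 0) →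
      (∃! p : Mp, ∀ v : X, ⟪w, v⟫ = b v p) ∧
        ∀ (p : Mp) (z : X), (∀ v : X, ⟪w, v⟫ = b v p) → L z = w →
          ‖p‖ ≤ β₀⁻¹ * Real.sqrt (a z z) := by
  intro w hw
  have hnonneg : ∀ v : X, 0 ≤ a v v := fun v => by
    rcases eq_or_ne v 0 with rfl | hv
    · simp
    · exact (hapos v hv).le
  refine ⟨?_, fun p z hp hz => ?_⟩
  · obtain ⟨p, hp⟩ := exists_eq_flip_apply b (innerₗ X w) hw
    refine ⟨p, hp, fun p' hp' => ?_⟩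
    have hker : ∀ v : X, b v (p' - p) ≤ 0 * √(a v v) := fun v => by
      have h : ⟪w, v⟫ = b v p := hp v
      simp [← hp' v, ← h]
    have h := norm_le_of_infSup hapos hβ₀ le_rfl (hinfsup _) hker
    rw [mul_zero] at h
    exact sub_eq_zero.1 (norm_le_zero_iff.1 h)
  · refine norm_le_of_infSup hapos hβ₀ (Real.sqrt_nonneg _) (hinfsup p) fun v => ?_
    rw [← hp v, ← hz, hL, ← Real.sqrt_mul (hnonneg z)]
    exact Real.le_sqrt_of_sq_le
      (LinearMap.BilinForm.apply_sq_le_of_symm a hnonneg ⟨hasymm⟩ z v)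
end

section
/- In the abstract dG(w) time-stepping framework, for every f ∈ L¹(I;V) and every u₀ ∈ V there exists exactly one dG(w) approximation u_τ ∈ X_τ^w(V), i.e., exactly one u_τ ∈ X_τ^w(V) satisfying ∑_{m=1}^M ∫_{I_m} (⟪∂_t u_τ(t), v(t)⟫ + ⟪A u_τ(t), v(t)⟫) dt + ∑_{m=2}^M ⟪[u_τ]_{m−1}, v_{m−1}^+⟫ + ⟪u_{τ,0}^+, v_0^+⟫ = ∫_I ⟪f(t), v(t)⟫ dt + ⟪u₀, v_0^+⟫ for all v ∈ X_τ^w(V). -/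
open MeasureTheory
open scoped RealInnerProductSpace

/-- `U m` is, for each `m = 1, …, M`, a `V`-valued polynomial of degree at most `w`
(the `m`-th piece of a function in `X_τ^w(V)`). -/
def PPoly {V : Type} [AddCommGroup V] [Module ℝ V] (w M : ℕ) (U : ℕ → ℝ → V) : Prop :=
  ∀ m, 1 ≤ m → m ≤ M → ∃ c : Fin (w + 1) → V, ∀ s : ℝ, U m s = ∑ j : Fin (w + 1), s ^ (j : ℕ) • c j

/-- The dG(w) scheme for `∂_t u + A u = f`, `u(0) = u₀`, on the partition
`0 = t 0 < t 1 < ⋯ < t M = T` (`U m` is the polynomial piece on `I_m = (t (m-1), t m]`):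
`∑_m ∫_{I_m} (⟪∂_t u, v⟫ + ⟪A u, v⟫) + ∑_{m=2}^M ⟪[u]_{m-1}, v_{m-1}^+⟫ + ⟪u_0^+, v_0^+⟫
 = ∫_I ⟪f, v⟫ + ⟪u₀, v_0^+⟫` for all piecewise polynomial test functions `v`. -/
def DGeq {V : Type} [NormedAddCommGroup V] [InnerProductSpace ℝ V]
    (w : ℕ) (A : V →ₗ[ℝ] V) (M : ℕ) (t : ℕ → ℝ) (f : ℝ → V) (u₀ : V)
    (U : ℕ → ℝ → V) : Prop :=
  ∀ Φ : ℕ → ℝ → V, PPoly w M Φ →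
    (∑ m ∈ Finset.Icc 1 M, ∫ σ in t (m - 1)..t m,
        (⟪deriv (U m) σ, Φ m σ⟫ + ⟪A (U m σ), Φ m σ⟫))
      + (∑ m ∈ Finset.Icc 2 M, ⟪U m (t (m - 1)) - U (m - 1) (t (m - 1)), Φ m (t (m - 1))⟫)
      + ⟪U 1 (t 0), Φ 1 (t 0)⟫
    = (∑ m ∈ Finset.Icc 1 M, ∫ σ in t (m - 1)..t m, ⟪f σ, Φ m σ⟫)
      + ⟪u₀, Φ 1 (t 0)⟫

section DGHelpers

variable {V : Type} [NormedAddCommGroup V] [InnerProductSpace ℝ V]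

/-- The `V`-valued polynomial with given coefficients, as a linear function of the coefficients. -/
noncomputable def polyCurve (V : Type) [NormedAddCommGroup V] [InnerProductSpace ℝ V] (w : ℕ) :
    (Fin (w + 1) → V) →ₗ[ℝ] (ℝ → V) where
  toFun c s := ∑ j : Fin (w + 1), s ^ (j : ℕ) • c j
  map_add' c d := by
    funext s
    simp [Finset.sum_add_distrib]
  map_smul' r c := by
    funext s
    simp [Finset.smul_sum, smul_comm r]

theorem polyCurve_apply {w : ℕ} (c : Fin (w + 1) → V) (s : ℝ) :
    polyCurve V w c s = ∑ j : Fin (w + 1), s ^ (j : ℕ) • c j := rfl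

theorem contDiff_polyCurve {w : ℕ} (c : Fin (w + 1) → V) : ContDiff ℝ 1 (polyCurve V w c) := by
  change ContDiff ℝ 1 fun s : ℝ => ∑ j : Fin (w + 1), s ^ (j : ℕ) • c j
  fun_prop

/-- A polynomial vanishing on a nondegenerate interval has zero coefficients. -/
theorem eq_zero_of_polyCurve_eq_zero {w : ℕ} (c : Fin (w + 1) → V) {a b : ℝ} (hab : a < b)
    (h : ∀ s ∈ Set.Icc a b, polyCurve V w c s = 0) : c = 0 := by
  funext i
  set p : Polynomial ℝ :=
    ∑ j : Fin (w + 1), Polynomial.monomial (j : ℕ) ⟪c j, c i⟫ with hp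
  have hp0 : p = 0 := by
    refine Polynomial.eq_zero_of_infinite_isRoot p ((Set.Icc_infinite hab).mono fun s hs => ?_)
    have hs' := congrArg (fun v => ⟪v, c i⟫) (h s hs)
    simp only [polyCurve_apply, sum_inner, real_inner_smul_left, inner_zero_left] at hs'
    simp only [Set.mem_ofPred_eq, Polynomial.IsRoot.def, hp, Polynomial.eval_finsetSum,
      Polynomial.eval_monomial]
    rw [← hs']
    exact Finset.sum_congr rfl fun j _ => mul_comm _ _
  have hcoeff : p.coeff (i : ℕ) = ⟪c i, c i⟫ := by
    simp [hp, Polynomial.coeff_monomial, Fin.val_inj]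
  rw [hp0, Polynomial.coeff_zero] at hcoeff
  exact inner_self_eq_zero.mp hcoeff.symm

/-- The family of polynomial pieces with given coefficients, extended by zero outside `1, …, M`. -/
noncomputable def polyPieces (V : Type) [NormedAddCommGroup V] [InnerProductSpace ℝ V] (w M : ℕ) :
    (Finset.Icc 1 M → Fin (w + 1) → V) →ₗ[ℝ] (ℕ → ℝ → V) :=
  LinearMap.pi fun m =>
    if h : m ∈ Finset.Icc 1 M then polyCurve V w ∘ₗ LinearMap.proj ⟨m, h⟩ else 0

theorem polyPieces_of_mem {w M m : ℕ} (c : Finset.Icc 1 M → Fin (w + 1) → V)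
    (h : m ∈ Finset.Icc 1 M) : polyPieces V w M c m = polyCurve V w (c ⟨m, h⟩) := by
  simp only [polyPieces, LinearMap.pi_apply, dif_pos h]
  rfl

theorem polyPieces_of_notMem {w M m : ℕ} (c : Finset.Icc 1 M → Fin (w + 1) → V)
    (h : m ∉ Finset.Icc 1 M) : polyPieces V w M c m = 0 := by
  simp only [polyPieces, LinearMap.pi_apply, dif_neg h]
  rfl

theorem contDiff_polyPieces {w M : ℕ} (c : Finset.Icc 1 M → Fin (w + 1) → V) (m : ℕ) :
    ContDiff ℝ 1 (polyPieces V w M c m) := by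
  by_cases h : m ∈ Finset.Icc 1 M
  · rw [polyPieces_of_mem c h]
    exact contDiff_polyCurve _
  · rw [polyPieces_of_notMem c h]
    exact contDiff_const

theorem pPoly_polyPieces {w M : ℕ} (c : Finset.Icc 1 M → Fin (w + 1) → V) :
    PPoly w M (polyPieces V w M c) := fun m h1 hm =>
  ⟨c ⟨m, Finset.mem_Icc.mpr ⟨h1, hm⟩⟩, fun s => by
    rw [polyPieces_of_mem c (Finset.mem_Icc.mpr ⟨h1, hm⟩), polyCurve_apply]⟩

theorem PPoly.exists_polyPieces {w M : ℕ} {U : ℕ → ℝ → V} (hU : PPoly w M U) :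
    ∃ c, ∀ m ∈ Finset.Icc 1 M, U m = polyPieces V w M c m := by
  choose c hc using hU
  refine ⟨fun m => c m (Finset.mem_Icc.mp m.2).1 (Finset.mem_Icc.mp m.2).2, fun m hm => ?_⟩
  funext s
  rw [polyPieces_of_mem _ hm, polyCurve_apply]
  exact hc m _ _ s

/-- The bilinear form on the left-hand side of the dG scheme. -/
noncomputable def dgForm (A : V →ₗ[ℝ] V) (M : ℕ) (t : ℕ → ℝ) (U Φ : ℕ → ℝ → V) : ℝ :=
  (∑ m ∈ Finset.Icc 1 M, ∫ σ in t (m - 1)..t m,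
      (⟪deriv (U m) σ, Φ m σ⟫ + ⟪A (U m σ), Φ m σ⟫))
    + (∑ m ∈ Finset.Icc 2 M, ⟪U m (t (m - 1)) - U (m - 1) (t (m - 1)), Φ m (t (m - 1))⟫)
    + ⟪U 1 (t 0), Φ 1 (t 0)⟫

/-- The linear functional on the right-hand side of the dG scheme. -/
noncomputable def dgLoad (M : ℕ) (t : ℕ → ℝ) (f : ℝ → V) (u₀ : V) (Φ : ℕ → ℝ → V) : ℝ :=
  (∑ m ∈ Finset.Icc 1 M, ∫ σ in t (m - 1)..t m, ⟪f σ, Φ m σ⟫) + ⟪u₀, Φ 1 (t 0)⟫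

theorem dgForm_congr (A : V →ₗ[ℝ] V) {M : ℕ} (hM : 1 ≤ M) (t : ℕ → ℝ) {U U' Φ Φ' : ℕ → ℝ → V}
    (hU : ∀ m ∈ Finset.Icc 1 M, U m = U' m) (hΦ : ∀ m ∈ Finset.Icc 1 M, Φ m = Φ' m) :
    dgForm A M t U Φ = dgForm A M t U' Φ' := by
  have h1 : 1 ∈ Finset.Icc 1 M := Finset.mem_Icc.mpr ⟨le_rfl, hM⟩
  unfold dgForm
  rw [hU 1 h1, hΦ 1 h1]
  congr 2
  · refine Finset.sum_congr rfl fun m hm => ?_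
    rw [hU m hm, hΦ m hm]
  · refine Finset.sum_congr rfl fun m hm => ?_
    rw [Finset.mem_Icc] at hm
    rw [hU m (Finset.mem_Icc.mpr (by omega)), hU (m - 1) (Finset.mem_Icc.mpr (by omega)),
      hΦ m (Finset.mem_Icc.mpr (by omega))]

theorem dgLoad_congr {M : ℕ} (hM : 1 ≤ M) (t : ℕ → ℝ) (f : ℝ → V) (u₀ : V) {Φ Φ' : ℕ → ℝ → V}
    (hΦ : ∀ m ∈ Finset.Icc 1 M, Φ m = Φ' m) :
    dgLoad M t f u₀ Φ = dgLoad M t f u₀ Φ' := by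
  unfold dgLoad
  rw [hΦ 1 (Finset.mem_Icc.mpr ⟨le_rfl, hM⟩)]
  congr 1
  refine Finset.sum_congr rfl fun m hm => ?_
  rw [hΦ m hm]

/-- The scheme only has to be tested against families `polyPieces V w M d`. -/
theorem dGeq_iff {w M : ℕ} (A : V →ₗ[ℝ] V) (hM : 1 ≤ M) (t : ℕ → ℝ) (f : ℝ → V) (u₀ : V)
    {U : ℕ → ℝ → V} {c : Finset.Icc 1 M → Fin (w + 1) → V}
    (hU : ∀ m ∈ Finset.Icc 1 M, U m = polyPieces V w M c m) :
    DGeq w A M t f u₀ U ↔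
      ∀ d, dgForm A M t (polyPieces V w M c) (polyPieces V w M d)
        = dgLoad M t f u₀ (polyPieces V w M d) := by
  constructor
  · intro h d
    rw [← dgForm_congr A hM t hU fun _ _ => rfl]
    exact h _ (pPoly_polyPieces d)
  · intro h Φ hΦ
    obtain ⟨d, hd⟩ := hΦ.exists_polyPieces
    change dgForm A M t U Φ = dgLoad M t f u₀ Φ
    rw [dgForm_congr A hM t hU hd, dgLoad_congr hM t f u₀ hd, h d]

section Linearity

variable [FiniteDimensional ℝ V]

theorem intervalIntegrable_dgForm (A : V →ₗ[ℝ] V) {u φ : ℝ → V} (hu : ContDiff ℝ 1 u)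
    (hφ : Continuous φ) (a b : ℝ) :
    IntervalIntegrable (fun σ => ⟪deriv u σ, φ σ⟫ + ⟪A (u σ), φ σ⟫) volume a b := by
  have h1 : Continuous (deriv u) := hu.continuous_deriv le_rfl
  have h2 : Continuous fun σ => A (u σ) :=
    A.continuous_of_finiteDimensional.comp hu.continuous
  exact ((h1.inner hφ).add (h2.inner hφ)).intervalIntegrable a b

theorem dgForm_add_left (A : V →ₗ[ℝ] V) (M : ℕ) (t : ℕ → ℝ) {U U' Φ : ℕ → ℝ → V}
    (hU : ∀ m, ContDiff ℝ 1 (U m)) (hU' : ∀ m, ContDiff ℝ 1 (U' m))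
    (hΦ : ∀ m, Continuous (Φ m)) :
    dgForm A M t (U + U') Φ = dgForm A M t U Φ + dgForm A M t U' Φ := by
  have h : ∀ m, (∫ σ in t (m - 1)..t m,
      (⟪deriv ((U + U') m) σ, Φ m σ⟫ + ⟪A ((U + U') m σ), Φ m σ⟫))
      = (∫ σ in t (m - 1)..t m, (⟪deriv (U m) σ, Φ m σ⟫ + ⟪A (U m σ), Φ m σ⟫))
        + ∫ σ in t (m - 1)..t m, (⟪deriv (U' m) σ, Φ m σ⟫ + ⟪A (U' m σ), Φ m σ⟫) := by
    intro m
    rw [← intervalIntegral.integral_add (intervalIntegrable_dgForm A (hU m) (hΦ m) _ _)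
      (intervalIntegrable_dgForm A (hU' m) (hΦ m) _ _)]
    refine intervalIntegral.integral_congr fun σ _ => ?_
    simp only [Pi.add_apply]
    rw [deriv_add ((hU m).differentiable one_ne_zero σ) ((hU' m).differentiable one_ne_zero σ),
      map_add, inner_add_left, inner_add_left]
    ring
  unfold dgForm
  simp only [h, Finset.sum_add_distrib]
  simp only [Pi.add_apply, inner_add_left, inner_sub_left, Finset.sum_add_distrib,
    Finset.sum_sub_distrib]
  ring

theorem dgForm_add_right (A : V →ₗ[ℝ] V) (M : ℕ) (t : ℕ → ℝ) {U Φ Φ' : ℕ → ℝ → V}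
    (hU : ∀ m, ContDiff ℝ 1 (U m)) (hΦ : ∀ m, Continuous (Φ m)) (hΦ' : ∀ m, Continuous (Φ' m)) :
    dgForm A M t U (Φ + Φ') = dgForm A M t U Φ + dgForm A M t U Φ' := by
  have h : ∀ m, (∫ σ in t (m - 1)..t m,
      (⟪deriv (U m) σ, (Φ + Φ') m σ⟫ + ⟪A (U m σ), (Φ + Φ') m σ⟫))
      = (∫ σ in t (m - 1)..t m, (⟪deriv (U m) σ, Φ m σ⟫ + ⟪A (U m σ), Φ m σ⟫))
        + ∫ σ in t (m - 1)..t m, (⟪deriv (U m) σ, Φ' m σ⟫ + ⟪A (U m σ), Φ' m σ⟫) := by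
    intro m
    rw [← intervalIntegral.integral_add (intervalIntegrable_dgForm A (hU m) (hΦ m) _ _)
      (intervalIntegrable_dgForm A (hU m) (hΦ' m) _ _)]
    refine intervalIntegral.integral_congr fun σ _ => ?_
    simp only [Pi.add_apply, inner_add_right]
    ring
  unfold dgForm
  simp only [h, Finset.sum_add_distrib]
  simp only [Pi.add_apply, inner_add_right, Finset.sum_add_distrib]
  ring

end Linearity

theorem dgForm_smul_left (A : V →ₗ[ℝ] V) (M : ℕ) (t : ℕ → ℝ) (r : ℝ) {U : ℕ → ℝ → V}
    (Φ : ℕ → ℝ → V) (hU : ∀ m, ContDiff ℝ 1 (U m)) :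
    dgForm A M t (r • U) Φ = r * dgForm A M t U Φ := by
  have h : ∀ m, (∫ σ in t (m - 1)..t m,
      (⟪deriv ((r • U) m) σ, Φ m σ⟫ + ⟪A ((r • U) m σ), Φ m σ⟫))
      = r * ∫ σ in t (m - 1)..t m, (⟪deriv (U m) σ, Φ m σ⟫ + ⟪A (U m σ), Φ m σ⟫) := by
    intro m
    rw [← intervalIntegral.integral_const_mul]
    refine intervalIntegral.integral_congr fun σ _ => ?_
    simp only [Pi.smul_apply]
    rw [deriv_const_smul _ ((hU m).differentiable one_ne_zero σ), map_smul,
      real_inner_smul_left, real_inner_smul_left]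
    ring
  unfold dgForm
  simp only [h]
  simp only [Pi.smul_apply, ← smul_sub, real_inner_smul_left, ← Finset.mul_sum]
  ring

theorem dgForm_smul_right (A : V →ₗ[ℝ] V) (M : ℕ) (t : ℕ → ℝ) (r : ℝ) (U Φ : ℕ → ℝ → V) :
    dgForm A M t U (r • Φ) = r * dgForm A M t U Φ := by
  unfold dgForm
  simp only [Pi.smul_apply, real_inner_smul_right, ← mul_add, ← Finset.mul_sum,
    intervalIntegral.integral_const_mul]

theorem intervalIntegrable_inner_polyPieces {w M : ℕ} {f : ℝ → V} {a b : ℝ}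
    (hf : IntervalIntegrable f volume a b) (d : Finset.Icc 1 M → Fin (w + 1) → V) (m : ℕ) :
    IntervalIntegrable (fun σ => ⟪f σ, polyPieces V w M d m σ⟫) volume a b := by
  by_cases h : m ∈ Finset.Icc 1 M
  · simp only [polyPieces_of_mem d h, polyCurve_apply, inner_sum, real_inner_smul_right]
    have hj : ∀ j ∈ (Finset.univ : Finset (Fin (w + 1))), IntervalIntegrable
        (fun σ => σ ^ (j : ℕ) * ⟪f σ, d ⟨m, h⟩ j⟫) volume a b := fun j _ =>
      IntervalIntegrable.continuousOn_mul ⟨hf.1.inner_const _, hf.2.inner_const _⟩ (by fun_prop)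
    simpa only [Finset.sum_fn] using IntervalIntegrable.sum _ hj
  · simp [polyPieces_of_notMem d h]

/-- The right-hand side of the dG scheme as a functional of the coefficients. -/
noncomputable def dgLoadDual (w M : ℕ) (t : ℕ → ℝ) (f : ℝ → V) (u₀ : V)
    (hf : ∀ m ∈ Finset.Icc 1 M, IntervalIntegrable f volume (t (m - 1)) (t m)) :
    Module.Dual ℝ (Finset.Icc 1 M → Fin (w + 1) → V) where
  toFun d := dgLoad M t f u₀ (polyPieces V w M d)
  map_add' d e := by
    unfold dgLoad
    rw [map_add, Pi.add_apply, Pi.add_apply, inner_add_right, add_add_add_comm,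
      ← Finset.sum_add_distrib]
    congr 1
    refine Finset.sum_congr rfl fun m hm => ?_
    rw [← intervalIntegral.integral_add (intervalIntegrable_inner_polyPieces (hf m hm) d m)
      (intervalIntegrable_inner_polyPieces (hf m hm) e m)]
    simp only [Pi.add_apply, inner_add_right]
  map_smul' r d := by
    unfold dgLoad
    simp only [map_smul, Pi.smul_apply, real_inner_smul_right, ← mul_add, ← Finset.mul_sum,
      intervalIntegral.integral_const_mul, RingHom.id_apply, smul_eq_mul]

/-- The left-hand side of the dG scheme as a map from coefficients to functionals. -/
noncomputable def dgFormDual [FiniteDimensional ℝ V] (w : ℕ) (A : V →ₗ[ℝ] V) (M : ℕ)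
    (t : ℕ → ℝ) :
    (Finset.Icc 1 M → Fin (w + 1) → V) →ₗ[ℝ]
      Module.Dual ℝ (Finset.Icc 1 M → Fin (w + 1) → V) :=
  LinearMap.mk₂ ℝ (fun c d => dgForm A M t (polyPieces V w M c) (polyPieces V w M d))
    (fun c c' d => by
      rw [map_add]
      exact dgForm_add_left A M t (contDiff_polyPieces c) (contDiff_polyPieces c')
        fun m => (contDiff_polyPieces d m).continuous)
    (fun r c d => by
      rw [map_smul]
      exact dgForm_smul_left A M t r _ (contDiff_polyPieces c))
    (fun c d d' => by
      rw [map_add]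
      exact dgForm_add_right A M t (contDiff_polyPieces c)
        (fun m => (contDiff_polyPieces d m).continuous)
        fun m => (contDiff_polyPieces d' m).continuous)
    (fun r c d => by
      rw [map_smul]
      exact dgForm_smul_right A M t r _ _)

theorem integral_inner_deriv_self {u : ℝ → V} (hu : ContDiff ℝ 1 u) (a b : ℝ) :
    ∫ σ in a..b, ⟪deriv u σ, u σ⟫ = (‖u b‖ ^ 2 - ‖u a‖ ^ 2) / 2 := by
  have hderiv : ∀ σ ∈ Set.uIcc a b,
      HasDerivAt (fun σ => ‖u σ‖ ^ 2 / 2) ⟪deriv u σ, u σ⟫ σ := by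
    intro σ _
    have h := ((hu.differentiable one_ne_zero σ).hasDerivAt.norm_sq).div_const 2
    rw [mul_div_cancel_left₀ _ two_ne_zero, real_inner_comm] at h
    exact h
  rw [intervalIntegral.integral_eq_sub_of_hasDerivAt hderiv
    (((hu.continuous_deriv le_rfl).inner hu.continuous).intervalIntegrable a b)]
  ring

/-- The time-derivative and jump terms of the dG form are nonnegative on the diagonal. -/
theorem sum_energy_ge (t : ℕ → ℝ) (U : ℕ → ℝ → V) {M : ℕ} (hM : 1 ≤ M) :
    ‖U M (t M)‖ ^ 2 / 2 ≤
      (∑ m ∈ Finset.Icc 1 M, (‖U m (t m)‖ ^ 2 - ‖U m (t (m - 1))‖ ^ 2) / 2)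
        + (∑ m ∈ Finset.Icc 2 M, ⟪U m (t (m - 1)) - U (m - 1) (t (m - 1)), U m (t (m - 1))⟫)
        + ⟪U 1 (t 0), U 1 (t 0)⟫ := by
  induction M, hM using Nat.le_induction with
  | base =>
    simp only [Finset.Icc_self, Finset.sum_singleton, real_inner_self_eq_norm_sq]
    norm_num
    nlinarith [sq_nonneg ‖U 1 (t 0)‖]
  | succ n hn ih =>
    rw [Finset.sum_Icc_succ_top (by omega), Finset.sum_Icc_succ_top (by omega)]
    simp only [Nat.add_sub_cancel]
    have h := norm_sub_sq_real (U n (t n)) (U (n + 1) (t n))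
    rw [inner_sub_left, real_inner_self_eq_norm_sq]
    nlinarith [sq_nonneg ‖U n (t n) - U (n + 1) (t n)‖]

theorem dgForm_self_ge [FiniteDimensional ℝ V] (A : V →ₗ[ℝ] V) {M : ℕ} (hM : 1 ≤ M) (t : ℕ → ℝ)
    {U : ℕ → ℝ → V} (hU : ∀ m, ContDiff ℝ 1 (U m)) :
    ∑ m ∈ Finset.Icc 1 M, ∫ σ in t (m - 1)..t m, ⟪A (U m σ), U m σ⟫ ≤ dgForm A M t U U := by
  have h : ∀ m, (∫ σ in t (m - 1)..t m, (⟪deriv (U m) σ, U m σ⟫ + ⟪A (U m σ), U m σ⟫))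
      = (‖U m (t m)‖ ^ 2 - ‖U m (t (m - 1))‖ ^ 2) / 2
        + ∫ σ in t (m - 1)..t m, ⟪A (U m σ), U m σ⟫ := by
    intro m
    rw [← integral_inner_deriv_self (hU m), intervalIntegral.integral_add]
    · exact (((hU m).continuous_deriv le_rfl).inner (hU m).continuous).intervalIntegrable _ _
    · exact ((A.continuous_of_finiteDimensional.comp (hU m).continuous).inner
        (hU m).continuous).intervalIntegrable _ _
  unfold dgForm
  simp only [h, Finset.sum_add_distrib]
  have := sum_energy_ge t U hM
  nlinarith [sq_nonneg ‖U M (t M)‖]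

theorem dgFormDual_injective [FiniteDimensional ℝ V] (w : ℕ) (A : V →ₗ[ℝ] V)
    (hA : ∀ v : V, v ≠ 0 → 0 < ⟪A v, v⟫) {M : ℕ} (hM : 1 ≤ M) (t : ℕ → ℝ)
    (ht : ∀ m ∈ Finset.Icc 1 M, t (m - 1) < t m) :
    Function.Injective (dgFormDual w A M t) := by
  rw [injective_iff_map_eq_zero]
  intro c hc
  have hU := contDiff_polyPieces c
  have hA' : ∀ v : V, 0 ≤ ⟪A v, v⟫ := fun v => by
    by_cases hv : v = 0
    · simp [hv]
    · exact (hA v hv).le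
  have hself : dgForm A M t (polyPieces V w M c) (polyPieces V w M c) = 0 :=
    LinearMap.congr_fun hc c
  have hnonneg : ∀ m ∈ Finset.Icc 1 M, 0 ≤ ∫ σ in t (m - 1)..t m,
      ⟪A (polyPieces V w M c m σ), polyPieces V w M c m σ⟫ := fun m hm =>
    intervalIntegral.integral_nonneg (ht m hm).le fun σ _ => hA' _
  have hsum := (Finset.sum_eq_zero_iff_of_nonneg hnonneg).mp
    (le_antisymm ((dgForm_self_ge A hM t hU).trans hself.le) (Finset.sum_nonneg hnonneg))
  funext ⟨m, hm⟩
  refine eq_zero_of_polyCurve_eq_zero (c ⟨m, hm⟩) (ht m hm) fun s hs => ?_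
  rw [← polyPieces_of_mem c hm]
  by_contra hne
  refine (intervalIntegral.integral_pos (ht m hm) ?_ (fun σ _ => hA' _) ⟨s, hs, hA _ hne⟩).ne'
    (hsum m hm)
  exact ((A.continuous_of_finiteDimensional.comp (hU m).continuous).inner
    (hU m).continuous).continuousOn

end DGHelpers

/-- **Existence and uniqueness of the dG(w) approximation.**
In the abstract dG(w) framework (with `A` symmetric and coercive), for every `f ∈ L¹(I;V)` and
`u₀ ∈ V` there is exactly one `u_τ ∈ X_τ^w(V)` satisfying the dG(w) scheme; uniqueness is the
statement that the polynomial pieces of any two solutions agree on the subintervals `I_m`. -/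
theorem stmt4 (V : Type) [NormedAddCommGroup V] [InnerProductSpace ℝ V] [FiniteDimensional ℝ V]
    (A : V →ₗ[ℝ] V) (lam0 : ℝ) (hlam0 : 0 < lam0)
    (hAsymm : ∀ v w' : V, ⟪A v, w'⟫ = ⟪v, A w'⟫)
    (hAcoerc : ∀ v : V, lam0 * ‖v‖ ^ 2 ≤ ⟪A v, v⟫)
    (T : ℝ) (hT : 0 < T) (M : ℕ) (hM : 1 ≤ M) (w : ℕ)
    (t : ℕ → ℝ) (ht0 : t 0 = 0) (htM : t M = T)
    (hmono : ∀ m, m < M → t m < t (m + 1))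
    (f : ℝ → V) (hf : IntegrableOn f (Set.Ioc 0 T)) (u₀ : V) :
    ∃ U : ℕ → ℝ → V, PPoly w M U ∧ DGeq w A M t f u₀ U ∧
      ∀ U' : ℕ → ℝ → V, PPoly w M U' → DGeq w A M t f u₀ U' →
        ∀ m, 1 ≤ m → m ≤ M → ∀ σ ∈ Set.Ioc (t (m - 1)) (t m), U' m σ = U m σ := by
  have hpos : ∀ v : V, v ≠ 0 → 0 < ⟪A v, v⟫ := fun v hv =>
    (mul_pos hlam0 (pow_pos (norm_pos_iff.mpr hv) 2)).trans_le (hAcoerc v)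
  have ht : ∀ m ∈ Finset.Icc 1 M, t (m - 1) < t m := fun m hm => by
    rw [Finset.mem_Icc] at hm
    have h := hmono (m - 1) (by omega)
    rwa [Nat.sub_add_cancel hm.1] at h
  have hle : ∀ n, n ≤ M → ∀ m, m ≤ n → t m ≤ t n := fun n hn m hmn => by
    induction n, hmn using Nat.le_induction with
    | base => exact le_rfl
    | succ k _ ih => exact (ih (by omega)).trans (hmono k (by omega)).le
  have hfm : ∀ m ∈ Finset.Icc 1 M, IntervalIntegrable f volume (t (m - 1)) (t m) := by
    intro m hm
    rw [intervalIntegrable_iff_integrableOn_Ioc_of_le (ht m hm).le]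
    rw [Finset.mem_Icc] at hm
    refine hf.mono_set (Set.Ioc_subset_Ioc ?_ ?_)
    · exact ht0 ▸ hle (m - 1) (by omega) 0 (Nat.zero_le _)
    · exact htM ▸ hle M le_rfl m hm.2
  have hinj := dgFormDual_injective w A hpos hM t ht
  have hsurj : Function.Surjective (dgFormDual w A M t) :=
    (LinearMap.injective_iff_surjective_of_finrank_eq_finrank
      Subspace.dual_finrank_eq.symm).mp hinj
  obtain ⟨c, hc⟩ := hsurj (dgLoadDual w M t f u₀ hfm)
  refine ⟨polyPieces V w M c, pPoly_polyPieces c,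
    (dGeq_iff A hM t f u₀ fun _ _ => rfl).mpr fun d => LinearMap.congr_fun hc d, ?_⟩
  intro U' hU' hDG m h1 hm σ _
  obtain ⟨c', hc'⟩ := hU'.exists_polyPieces
  have hload : dgFormDual w A M t c' = dgLoadDual w M t f u₀ hfm :=
    LinearMap.ext ((dGeq_iff A hM t f u₀ hc').mp hDG)
  rw [hc' m (Finset.mem_Icc.mpr ⟨h1, hm⟩), hinj (hload.trans hc.symm)]
end

section
/- Discrete smoothing estimate (dG(w) analogue of Theorem 4.1): there exists a constant C, depending only on the polynomial degree w and the mesh constants κ, c, β (in particular independent of T, M, the partition, V, A, λ₀ and u₀), such that the following holds. In the abstract dG(w) framework, let f = 0 and u₀ ∈ V, and let u_τ ∈ X_τ^w(V) be the dG(w) approximation. Then for every m = 1,…,M, sup_{t∈I_m} ‖∂_t u_τ(t)‖ + sup_{t∈I_m} ‖A u_τ(t)‖ + τ_m⁻¹‖[u_τ]_{m−1}‖ ≤ (C/t_m)·‖u₀‖, where [u_τ]_0 = u_{τ,0}^+ − u₀. -/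
open MeasureTheory
open scoped RealInnerProductSpace

open Polynomial in
theorem exists_pos_mul_sq_norm_le_integral (n : ℕ) :
    ∃ k : ℝ, 0 < k ∧ ∀ c : Fin n → ℝ,
      k * ‖c‖ ^ 2 ≤ ∫ x in (0 : ℝ)..1, x * (∑ j, c j * x ^ (j : ℕ)) ^ 2 := by
  set Q : (Fin n → ℝ) → ℝ := fun c => ∫ x in (0 : ℝ)..1, x * (∑ j, c j * x ^ (j : ℕ)) ^ 2 with hQ
  have hcont : Continuous Q := by
    apply intervalIntegral.continuous_parametric_intervalIntegral_of_continuous'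
    simp only [Function.uncurry_def]
    fun_prop
  have hpos : ∀ c, c ≠ 0 → 0 < Q c := by
    intro c hc
    apply intervalIntegral.integral_pos one_pos (by fun_prop)
    · intro x hx
      have := hx.1.le
      positivity
    · by_contra! h
      apply hc
      set p : ℝ[X] := ∑ j : Fin n, monomial (j : ℕ) (c j) with hp
      have heval : ∀ x, p.eval x = ∑ j, c j * x ^ (j : ℕ) := by
        intro x
        simp [hp, eval_finsetSum]
      have hp0 : p = 0 := by
        apply eq_zero_of_infinite_isRoot
        refine (Set.Ioc_infinite (zero_lt_one (α := ℝ))).mono ?_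
        intro x hx
        have h1 := h x ⟨hx.1.le, hx.2⟩
        have h2 : (∑ j, c j * x ^ (j : ℕ)) ^ 2 ≤ 0 := by
          by_contra! h3
          exact absurd (mul_pos hx.1 h3) (not_lt.2 h1)
        change p.eval x = 0
        rw [heval]
        exact pow_eq_zero_iff two_ne_zero |>.1 (le_antisymm h2 (sq_nonneg _))
      funext i
      have h1 : p.coeff i = c i := by
        simp [hp, coeff_monomial, Fin.val_inj]
      rw [← h1, hp0]
      simp
  have hhom : ∀ (r : ℝ) (c : Fin n → ℝ), Q (r • c) = r ^ 2 * Q c := by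
    intro r c
    simp only [hQ, ← intervalIntegral.integral_const_mul]
    congr 1
    funext x
    simp only [Pi.smul_apply, smul_eq_mul, mul_assoc, ← Finset.mul_sum]
    ring
  rcases (Metric.sphere (0 : Fin n → ℝ) 1).eq_empty_or_nonempty with he | hne
  · refine ⟨1, one_pos, fun c => ?_⟩
    have hc : c = 0 := by
      by_contra hc
      have : ‖c‖⁻¹ • c ∈ Metric.sphere (0 : Fin n → ℝ) 1 := by
        simp [norm_smul, hc]
      simp [he] at this
    simp [hc]
  · obtain ⟨c₀, hc₀, hmin⟩ :=
      (isCompact_sphere (0 : Fin n → ℝ) 1).exists_isMinOn hne hcont.continuousOn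
    refine ⟨Q c₀, hpos _ (fun h => by simp [h] at hc₀), fun c => ?_⟩
    by_cases hc : c = 0
    · simp [hc]
    · have h1 : ‖c‖⁻¹ • c ∈ Metric.sphere (0 : Fin n → ℝ) 1 := by
        simp [norm_smul, hc]
      have h2 : Q c₀ ≤ Q (‖c‖⁻¹ • c) := hmin h1
      rw [hhom] at h2
      have h3 : 0 < ‖c‖ := norm_pos_iff.2 hc
      change Q c₀ * ‖c‖ ^ 2 ≤ Q c
      calc Q c₀ * ‖c‖ ^ 2 ≤ (‖c‖⁻¹ ^ 2 * Q c) * ‖c‖ ^ 2 := by gcongr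
        _ = Q c := by field_simp

open Polynomial in
/-- On polynomials of degree at most `w`, the weighted `L²(0,1)` norm controls the sup norm of the
polynomial and of its derivative. -/
theorem exists_sq_eval_le_integral (w : ℕ) :
    ∃ K : ℝ, 1 ≤ K ∧ ∀ p : ℝ[X], p.natDegree ≤ w → ∀ s ∈ Set.Icc (0 : ℝ) 1,
      (p.eval s) ^ 2 ≤ K * ∫ x in (0 : ℝ)..1, x * (p.eval x) ^ 2 ∧
      (p.derivative.eval s) ^ 2 ≤ K * ∫ x in (0 : ℝ)..1, x * (p.eval x) ^ 2 := by
  obtain ⟨k, hk, hle⟩ := exists_pos_mul_sq_norm_le_integral (w + 1)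
  refine ⟨((w + 1 : ℝ) * (w + 1)) ^ 2 / k + 1, by
    have : 0 ≤ ((w + 1 : ℝ) * (w + 1)) ^ 2 / k := by positivity
    linarith, fun p hp s hs => ?_⟩
  set c : Fin (w + 1) → ℝ := fun j => p.coeff j with hc
  have heval : ∀ x, p.eval x = ∑ j, c j * x ^ (j : ℕ) := fun x => by
    rw [eval_eq_sum_range' (Nat.lt_succ_of_le hp), Finset.sum_range]
  have hder : p.derivative.eval s = ∑ j, c j * (j * s ^ ((j : ℕ) - 1)) := by
    rw [derivative_eval, sum_over_range' _ (by simp) (w + 1) (Nat.lt_succ_of_le hp),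
      Finset.sum_range]
    simp [hc, mul_assoc]
  set J := ∫ x in (0 : ℝ)..1, x * (p.eval x) ^ 2 with hJ
  have hJle : k * ‖c‖ ^ 2 ≤ J := by
    simpa only [hJ, heval] using hle c
  have hs1 : ∀ j : ℕ, |s ^ j| ≤ 1 := fun j => by
    rw [abs_of_nonneg (pow_nonneg hs.1 _)]
    exact pow_le_one₀ hs.1 hs.2
  have hcj : ∀ j, |c j| ≤ ‖c‖ := fun j => norm_le_pi_norm c j
  have hsum : ∀ g : Fin (w + 1) → ℝ, (∀ j, |g j| ≤ w + 1) →
      (∑ j, c j * g j) ^ 2 ≤ (((w + 1 : ℝ) * (w + 1)) ^ 2 / k + 1) * J := by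
    intro g hg
    have h1 : |∑ j, c j * g j| ≤ (w + 1) * (w + 1) * ‖c‖ := by
      calc |∑ j, c j * g j| ≤ ∑ j, |c j * g j| := Finset.abs_sum_le_sum_abs _ _
        _ ≤ ∑ _j : Fin (w + 1), ‖c‖ * (w + 1) := by
          refine Finset.sum_le_sum fun j _ => ?_
          rw [abs_mul]
          exact mul_le_mul (hcj j) (hg j) (abs_nonneg _) (norm_nonneg _)
        _ = _ := by simp; ring
    have hJ0 : 0 ≤ J := le_trans (by positivity) hJle
    calc (∑ j, c j * g j) ^ 2 ≤ ((w + 1) * (w + 1) * ‖c‖) ^ 2 := by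
          rw [← sq_abs]; gcongr
      _ = ((w + 1 : ℝ) * (w + 1)) ^ 2 / k * (k * ‖c‖ ^ 2) := by field_simp
      _ ≤ ((w + 1 : ℝ) * (w + 1)) ^ 2 / k * J := by gcongr
      _ ≤ _ := by nlinarith
  constructor
  · rw [heval]
    refine hsum _ fun j => (hs1 _).trans ?_
    have : (0 : ℝ) ≤ w := by positivity
    linarith
  · rw [hder]
    refine hsum _ fun j => ?_
    rw [abs_mul, Nat.abs_cast]
    have h1 : ((j : ℕ) : ℝ) ≤ w + 1 := by exact_mod_cast j.2.le
    calc ((j : ℕ) : ℝ) * |s ^ ((j : ℕ) - 1)| ≤ (w + 1) * 1 := by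
          gcongr
          exact hs1 _
      _ = _ := mul_one _

set_option maxHeartbeats 1000000 in
open Polynomial in
/-- Stability and damping of one step of the dG(w) scheme for `y' + z y = 0` on `[0, 1]`
with incoming value `a`. -/
theorem exists_dG_step_bound (w : ℕ) :
    ∃ C δ : ℝ, 0 < C ∧ 0 < δ ∧ δ ≤ 1 ∧ ∀ (z a : ℝ) (p : ℝ[X]), 0 < z → p.natDegree ≤ w →
      (∀ q : ℝ[X], q.natDegree ≤ w →
        (∫ x in (0 : ℝ)..1, (p.derivative.eval x + z * p.eval x) * q.eval x)
          + (p.eval 0 - a) * q.eval 0 = 0) →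
      (∀ s ∈ Set.Icc (0 : ℝ) 1, (1 + z) * |p.eval s| ≤ C * |a| ∧
        (1 + z) * |p.derivative.eval s| ≤ C * z * |a|) ∧
      (1 + z) * |p.eval 0 - a| ≤ C * z * |a| ∧
      (1 + δ * z) * |p.eval 1| ≤ |a| := by
  obtain ⟨K, hK1, hK⟩ := exists_sq_eval_le_integral w
  have hK0 : 0 < K := by linarith
  -- the constant in `B ≤ C₁ * |a|` and in `(1 + z) * B ≤ C₂ * |a|`
  set C₁ : ℝ := 4 * K ^ 2 with hC₁
  set C₂ : ℝ := C₁ + K * (C₁ + 1) with hC₂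
  have hC₁p : 1 ≤ C₁ := by nlinarith
  have hC₂p : 1 ≤ C₂ := by nlinarith
  set C : ℝ := (K + 1) * C₂ with hC
  have hC₂C : C₂ ≤ C := by nlinarith
  have hKC₂C : K * C₂ ≤ C := by nlinarith
  set δ : ℝ := 1 / (4 * K * C₂) with hδ
  have hKC : 1 ≤ K * C₂ := by nlinarith
  have hδp : 0 < δ := by positivity
  have hδ1 : δ * (4 * K * C₂) = 1 := by rw [hδ]; field_simp
  have hδle : δ ≤ 1 := by nlinarith
  refine ⟨C, δ, by positivity, hδp, hδle, fun z a p hz hp heq => ?_⟩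
  have hint : ∀ f : ℝ[X], IntervalIntegrable (fun x => f.eval x) volume 0 1 :=
    fun f => f.continuous.intervalIntegrable _ _
  have hp' : p.derivative.natDegree ≤ w := (natDegree_derivative_le p).trans (by omega)
  set J := ∫ x in (0 : ℝ)..1, x * (p.eval x) ^ 2 with hJ
  set J' := ∫ x in (0 : ℝ)..1, x * (p.derivative.eval x) ^ 2 with hJ'
  set B := √(K * J) with hB
  set D := √(K * J') with hD
  have hJ0 : 0 ≤ J := intervalIntegral.integral_nonneg zero_le_one
    fun x hx => mul_nonneg hx.1 (sq_nonneg _)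
  have hJ'0 : 0 ≤ J' := intervalIntegral.integral_nonneg zero_le_one
    fun x hx => mul_nonneg hx.1 (sq_nonneg _)
  have hB2 : B ^ 2 = K * J := Real.sq_sqrt (by positivity)
  have hD2 : D ^ 2 = K * J' := Real.sq_sqrt (by positivity)
  have hB0 : 0 ≤ B := Real.sqrt_nonneg _
  have hD0 : 0 ≤ D := Real.sqrt_nonneg _
  have hpB : ∀ s ∈ Set.Icc (0 : ℝ) 1, |p.eval s| ≤ B := fun s hs =>
    Real.abs_le_sqrt (hK p hp s hs).1
  have hp'B : ∀ s ∈ Set.Icc (0 : ℝ) 1, |p.derivative.eval s| ≤ B := fun s hs =>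
    Real.abs_le_sqrt (hK p hp s hs).2
  have hp'D : ∀ s ∈ Set.Icc (0 : ℝ) 1, |p.derivative.eval s| ≤ D := fun s hs =>
    Real.abs_le_sqrt (hK _ hp' s hs).1
  have hbound : ∀ (f : ℝ[X]) (L : ℝ), (∀ s ∈ Set.Icc (0 : ℝ) 1, |f.eval s| ≤ L) →
      |∫ x in (0 : ℝ)..1, f.eval x| ≤ L := by
    intro f L hf
    have := intervalIntegral.norm_integral_le_of_norm_le_const (a := (0 : ℝ)) (b := 1)
      (f := fun x => f.eval x) (C := L) (fun x hx => by
        rw [Set.uIoc_of_le zero_le_one] at hx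
        exact hf x ⟨hx.1.le, hx.2⟩)
    simpa using this
  have h0 : (0 : ℝ) ∈ Set.Icc (0 : ℝ) 1 := by simp
  have h1 : (1 : ℝ) ∈ Set.Icc (0 : ℝ) 1 := by simp
  set P2 := ∫ x in (0 : ℝ)..1, (p.eval x) ^ 2 with hP2
  have hJP2 : J ≤ P2 := by
    apply intervalIntegral.integral_mono_on zero_le_one
    · exact (by fun_prop : Continuous fun x => x * (p.eval x) ^ 2).intervalIntegrable _ _
    · exact (by fun_prop : Continuous fun x => (p.eval x) ^ 2).intervalIntegrable _ _
    · intro x hx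
      exact mul_le_of_le_one_left (sq_nonneg _) hx.2
  have hderiv_int : ∀ f : ℝ[X],
      ∫ x in (0 : ℝ)..1, f.derivative.eval x = f.eval 1 - f.eval 0 := fun f =>
    intervalIntegral.integral_eq_sub_of_hasDerivAt (fun x _ => f.hasDerivAt x) (hint _)
  -- testing with `p`
  have htest : (∫ x in (0 : ℝ)..1, (p.derivative * p).eval x) + z * P2
      + (p.eval 0 - a) * p.eval 0 = 0 := by
    have h := heq p hp
    refine Eq.trans ?_ h
    rw [hP2, ← intervalIntegral.integral_const_mul, ← intervalIntegral.integral_add (hint _)]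
    · congr 2
      funext x
      simp only [eval_mul]
      ring
    · exact (by fun_prop : Continuous fun x => z * (p.eval x) ^ 2).intervalIntegrable _ _
  have hpp : ∫ x in (0 : ℝ)..1, (p.derivative * p).eval x
      = ((p.eval 1) ^ 2 - (p.eval 0) ^ 2) / 2 := by
    have h := hderiv_int (p * p)
    have h2 : ∫ x in (0 : ℝ)..1, (p * p).derivative.eval x
        = 2 * ∫ x in (0 : ℝ)..1, (p.derivative * p).eval x := by
      rw [← intervalIntegral.integral_const_mul]
      congr 1
      funext x
      simp only [derivative_mul, eval_mul, eval_add]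
      ring
    rw [h2] at h
    simp only [eval_mul] at h ⊢
    linarith
  have henergy : (p.eval 1) ^ 2 + (p.eval 0 - a) ^ 2 + 2 * (z * P2) = a ^ 2 := by
    rw [hpp] at htest
    linarith
  have hzJ : z * J ≤ z * P2 := by gcongr
  have hzJ0 : 0 ≤ z * J := by positivity
  have hjump : |p.eval 0 - a| ≤ |a| := by
    apply sq_le_sq.1
    linarith [sq_nonneg (p.eval 1)]
  have hp0 : |p.eval 0| ≤ 2 * |a| := by
    have := abs_sub_abs_le_abs_sub (p.eval 0) a
    linarith
  -- testing with `x * p'`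
  have hDB : D ≤ K * z * B := by
    have hq : (X * p.derivative).natDegree ≤ w := by
      by_cases hw : p.natDegree = 0
      · rw [derivative_of_natDegree_zero hw]; simp
      · refine natDegree_mul_le.trans ?_
        have := natDegree_derivative_le p
        simp only [natDegree_X]
        omega
    have h := heq _ hq
    have h2 : J' + z * ∫ x in (0 : ℝ)..1, (X * p * p.derivative).eval x = 0 := by
      refine Eq.trans ?_ h
      rw [hJ', ← intervalIntegral.integral_const_mul,
        ← intervalIntegral.integral_add _ ((hint _).const_mul z)]
      · simp only [eval_mul, eval_X, zero_mul, mul_zero, add_zero]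
        congr 1
        funext x
        ring
      · exact (by fun_prop : Continuous fun x =>
          x * (p.derivative.eval x) ^ 2).intervalIntegrable _ _
    have h3 := hbound (X * p * p.derivative) (B * D) fun s hs => by
      simp only [eval_mul, eval_X, abs_mul]
      have hs' : |s| ≤ 1 := by rw [abs_of_nonneg hs.1]; exact hs.2
      calc |s| * |p.eval s| * |p.derivative.eval s| ≤ 1 * B * D := by
            gcongr
            · exact hpB s hs
            · exact hp'D s hs
        _ = B * D := by ring
    have h4 : J' ≤ z * (B * D) := by
      have := mul_le_mul_of_nonneg_left (abs_le.1 h3).1 hz.le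
      linarith
    have h5 : D * D ≤ K * z * B * D := by
      linarith [mul_le_mul_of_nonneg_left h4 hK0.le]
    rcases hD0.eq_or_lt with h6 | h6
    · rw [← h6]; positivity
    · exact le_of_mul_le_mul_right h5 h6
  have hsup : ∀ s ∈ Set.Icc (0 : ℝ) 1, |p.eval s| ≤ 2 * |a| + D := by
    intro s hs
    have h2 := Convex.norm_image_sub_le_of_norm_hasDerivWithin_le (f := fun x => p.eval x)
      (f' := fun x => p.derivative.eval x) (s := Set.Icc (0 : ℝ) 1) (C := D)
      (fun x _ => (p.hasDerivAt x).hasDerivWithinAt) (fun x hx => hp'D x hx)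
      (convex_Icc 0 1) h0 hs
    have h3 : D * ‖s - 0‖ ≤ D := by
      rw [sub_zero, Real.norm_eq_abs, abs_of_nonneg hs.1]
      exact mul_le_of_le_one_right hD0 hs.2
    have h4 := abs_sub_abs_le_abs_sub (p.eval s) (p.eval 0)
    rw [Real.norm_eq_abs] at h2
    linarith
  have hBle : B ≤ K * (2 * |a| + D) := by
    have hL : 0 ≤ 2 * |a| + D := by positivity
    have h2 : J ≤ (2 * |a| + D) ^ 2 := by
      have h3 := hbound (X * p ^ 2) ((2 * |a| + D) ^ 2) fun s hs => by
        simp only [eval_mul, eval_X, eval_pow, abs_mul, abs_pow]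
        have hs' : |s| ≤ 1 := by rw [abs_of_nonneg hs.1]; exact hs.2
        calc |s| * |p.eval s| ^ 2 ≤ 1 * (2 * |a| + D) ^ 2 := by
              gcongr
              exact hsup s hs
          _ = _ := one_mul _
      have h4 := le_trans (le_abs_self _) h3
      simpa only [eval_mul, eval_X, eval_pow] using h4
    apply Real.sqrt_le_iff.2
    refine ⟨by positivity, ?_⟩
    calc K * J ≤ K * (2 * |a| + D) ^ 2 := by gcongr
      _ ≤ K ^ 2 * (2 * |a| + D) ^ 2 := by gcongr; exact le_self_pow₀ hK1 two_ne_zero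
      _ = _ := by ring
  have ha0 := abs_nonneg a
  have hsmall : B ≤ C₁ * |a| := by
    rcases le_total (2 * K ^ 2 * z) 1 with hz1 | hz1
    · have h2 := mul_le_mul_of_nonneg_left hDB hK0.le
      have h3 := mul_le_mul_of_nonneg_right hz1 hB0
      have h4 : K * |a| ≤ K ^ 2 * |a| := by gcongr; exact le_self_pow₀ hK1 two_ne_zero
      rw [hC₁]
      linarith
    · have h2 : 2 * z * B ^ 2 ≤ K * a ^ 2 := by
        rw [hB2]
        have : 2 * (z * J) ≤ a ^ 2 := by linarith [sq_nonneg (p.eval 1), sq_nonneg (p.eval 0 - a)]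
        linarith [mul_le_mul_of_nonneg_left this hK0.le]
      have h3 : B ^ 2 ≤ K ^ 3 * a ^ 2 := by
        calc B ^ 2 = 1 * B ^ 2 := (one_mul _).symm
          _ ≤ 2 * K ^ 2 * z * B ^ 2 := by gcongr
          _ = K ^ 2 * (2 * z * B ^ 2) := by ring
          _ ≤ K ^ 2 * (K * a ^ 2) := by gcongr
          _ = _ := by ring
      refine le_of_pow_le_pow_left₀ two_ne_zero (by positivity) ?_
      calc B ^ 2 ≤ K ^ 3 * a ^ 2 := h3
        _ ≤ K ^ 4 * a ^ 2 := by
          gcongr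
          norm_num
        _ ≤ 16 * (K ^ 4 * a ^ 2) := by linarith [show 0 ≤ K ^ 4 * a ^ 2 by positivity]
        _ = (C₁ * |a|) ^ 2 := by rw [hC₁, mul_pow, sq_abs]; ring
  have hlarge : z * B ≤ K * (B + |a|) := by
    have h2 := hbound (p.derivative * p) (B * B) fun s hs => by
      simp only [eval_mul, abs_mul]
      exact mul_le_mul (hp'B s hs) (hpB s hs) (abs_nonneg _) hB0
    have h3 : |(p.eval 0 - a) * p.eval 0| ≤ |a| * B := by
      rw [abs_mul]
      exact mul_le_mul hjump (hpB 0 h0) (abs_nonneg _) ha0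
    have h4 : z * P2 ≤ B * B + |a| * B := by
      linarith [(abs_le.1 h2).1, (abs_le.1 h3).1]
    have h5 : z * B * B ≤ K * (B + |a|) * B := by
      have : z * B * B = K * (z * J) := by linear_combination z * hB2
      rw [this]
      linarith [mul_le_mul_of_nonneg_left (hzJ.trans h4) hK0.le]
    rcases hB0.eq_or_lt with h6 | h6
    · rw [← h6]; simp; positivity
    · exact le_of_mul_le_mul_right h5 h6
  have hmain : (1 + z) * B ≤ C₂ * |a| := by
    have : K * B ≤ K * (C₁ * |a|) := by gcongr
    rw [hC₂]
    linarith
  have hz1 : 0 < 1 + z := by linarith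
  refine ⟨fun s hs => ⟨?_, ?_⟩, ?_, ?_⟩
  · calc (1 + z) * |p.eval s| ≤ (1 + z) * B := by gcongr; exact hpB s hs
      _ ≤ C₂ * |a| := hmain
      _ ≤ C * |a| := by gcongr
  · calc (1 + z) * |p.derivative.eval s| ≤ (1 + z) * (K * z * B) := by
          gcongr; exact (hp'D s hs).trans hDB
      _ = K * z * ((1 + z) * B) := by ring
      _ ≤ K * z * (C₂ * |a|) := by gcongr
      _ = K * C₂ * (z * |a|) := by ring
      _ ≤ C * (z * |a|) := by gcongr
      _ = _ := by ring
  · have h2 := heq 1 (by simp)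
    simp only [eval_one, mul_one] at h2
    have h3 := hbound (p.derivative + Polynomial.C z * p) ((K + 1) * (z * B)) fun s hs => by
      simp only [eval_add, eval_mul, eval_C]
      calc |p.derivative.eval s + z * p.eval s| ≤ |p.derivative.eval s| + |z * p.eval s| :=
            abs_add_le _ _
        _ ≤ K * z * B + z * B := by
          rw [abs_mul, abs_of_pos hz]
          gcongr
          · exact (hp'D s hs).trans hDB
          · exact hpB s hs
        _ = _ := by ring
    simp only [eval_add, eval_mul, eval_C] at h3
    have h4 : |p.eval 0 - a| ≤ (K + 1) * (z * B) := by
      rw [eq_neg_of_add_eq_zero_right h2, abs_neg]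
      exact h3
    calc (1 + z) * |p.eval 0 - a| ≤ (1 + z) * ((K + 1) * (z * B)) := by gcongr
      _ = (K + 1) * z * ((1 + z) * B) := by ring
      _ ≤ (K + 1) * z * (C₂ * |a|) := by gcongr
      _ = _ := by rw [hC]; ring
  · rcases le_total z (2 * C₂) with hz2 | hz2
    · have h2 : (p.eval 1) ^ 2 ≤ K * J := (hK p hp 1 h1).1
      have h3 : (K + 2 * z) * (p.eval 1) ^ 2 ≤ K * a ^ 2 := by
        have h4 : (p.eval 1) ^ 2 + 2 * (z * J) ≤ a ^ 2 := by
          linarith [sq_nonneg (p.eval 0 - a)]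
        linarith [mul_le_mul_of_nonneg_left h2 hz.le, mul_le_mul_of_nonneg_left h4 hK0.le]
      have h4 : K * (1 + δ * z) ^ 2 ≤ K + 2 * z := by
        have h5 : δ * K * z ≤ δ * K * (2 * C₂) := by gcongr
        have h6 : δ * z * (δ * K * z) ≤ δ * z * (δ * K * (2 * C₂)) := by gcongr
        have h7 : δ * K * z * 1 ≤ δ * K * z * C₂ := by gcongr
        have h8 : δ * z ≤ 1 * z := by gcongr
        have h9 : δ * K * C₂ = 1 / 4 := by linarith
        have h10 : δ * K * z * C₂ = z / 4 := by linear_combination z * h9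
        have h11 : δ * z * (δ * K * (2 * C₂)) = δ * z / 2 := by linear_combination 2 * δ * z * h9
        linarith
      refine le_of_pow_le_pow_left₀ two_ne_zero ha0 ?_
      have h5 : K * ((1 + δ * z) * |p.eval 1|) ^ 2 ≤ K * |a| ^ 2 := by
        rw [mul_pow, sq_abs, sq_abs, ← mul_assoc]
        exact (mul_le_mul_of_nonneg_right h4 (sq_nonneg _)).trans h3
      exact le_of_mul_le_mul_left h5 hK0
    · have h2 : (1 + z) * |p.eval 1| ≤ C₂ * |a| :=
        le_trans (by gcongr; exact hpB 1 h1) hmain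
      have h3 : C₂ * (1 + δ * z) ≤ 1 + z := by
        have h4 : δ * C₂ * z * 1 ≤ δ * C₂ * z * K := by gcongr
        have h5 : δ * C₂ * z * K = z / 4 := by linear_combination z / 4 * hδ1
        linarith
      have h4 : C₂ * ((1 + δ * z) * |p.eval 1|) ≤ C₂ * |a| := by
        rw [← mul_assoc]
        exact (mul_le_mul_of_nonneg_right h3 (abs_nonneg _)).trans h2
      exact le_of_mul_le_mul_left h4 (by linarith)

open Polynomial in
/-- The homogeneous dG(w) scheme localises to a single time interval. -/
theorem DGeq.local_eq {V : Type} [NormedAddCommGroup V] [InnerProductSpace ℝ V]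
    {w : ℕ} {A : V →ₗ[ℝ] V} {M : ℕ} {t : ℕ → ℝ} {u₀ : V} {U : ℕ → ℝ → V}
    (h : DGeq w A M t (fun _ => (0 : V)) u₀ U) {m : ℕ} (hm : 1 ≤ m) (hmM : m ≤ M)
    {q : ℝ[X]} (hq : q.natDegree ≤ w) (e : V) :
    (∫ σ in t (m - 1)..t m, (⟪deriv (U m) σ, e⟫ + ⟪A (U m σ), e⟫) * q.eval σ)
      + ⟪U m (t (m - 1)) - (if m = 1 then u₀ else U (m - 1) (t (m - 1))), e⟫
        * q.eval (t (m - 1)) = 0 := by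
  have hΦ := h (fun k σ => if k = m then q.eval σ • e else 0) (by
    intro k _ _
    refine ⟨fun j => if k = m then q.coeff j • e else 0, fun s => ?_⟩
    by_cases hk : k = m
    · simp only [hk, if_true]
      rw [eval_eq_sum_range' (Nat.lt_succ_of_le hq), Finset.sum_range, Finset.sum_smul]
      exact Finset.sum_congr rfl fun j _ => by rw [smul_smul, mul_comm]
    · simp [hk])
  rw [Finset.sum_eq_single m (fun k _ hk => by simp [hk])
    (fun hk => absurd (Finset.mem_Icc.2 ⟨hm, hmM⟩) hk)] at hΦ
  simp only [if_true, inner_zero_left, intervalIntegral.integral_zero, Finset.sum_const_zero,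
    zero_add, inner_smul_right] at hΦ
  have hint : (∫ σ in t (m - 1)..t m, (⟪deriv (U m) σ, e⟫ + ⟪A (U m σ), e⟫) * q.eval σ)
      = ∫ σ in t (m - 1)..t m, (q.eval σ * ⟪deriv (U m) σ, e⟫ + q.eval σ * ⟪A (U m σ), e⟫) := by
    congr 1
    funext σ
    ring
  rw [hint]
  rcases hm.eq_or_lt with rfl | hm1
  · rw [Finset.sum_eq_zero fun k hk => by
      have : k ≠ 1 := by have := (Finset.mem_Icc.1 hk).1; omega
      simp [this]] at hΦ
    simp only [if_true, inner_smul_right, inner_sub_left, Nat.sub_self] at hΦ ⊢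
    linarith
  · rw [Finset.sum_eq_single m (fun k _ hk => by simp [hk])
      (fun hk => absurd (Finset.mem_Icc.2 ⟨hm1, hmM⟩) hk)] at hΦ
    simp only [if_true, inner_smul_right, hm1.ne, hm1.ne', if_false, inner_zero_right,
      add_zero] at hΦ ⊢
    linarith

open Polynomial in
/-- The one-step bounds for the component of the dG(w) solution along an eigenvector. -/
theorem exists_dG_eigenvector_step_bound (w : ℕ) :
    ∃ C δ : ℝ, 0 < C ∧ 0 < δ ∧ δ ≤ 1 ∧
      ∀ (V : Type) [NormedAddCommGroup V] [InnerProductSpace ℝ V] (A : V →ₗ[ℝ] V) (e v : V)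
        (lam t₀ t₁ : ℝ) (c : Fin (w + 1) → V) (u : ℝ → V),
        (∀ v w' : V, ⟪A v, w'⟫ = ⟪v, A w'⟫) → A e = lam • e → 0 < lam → t₀ < t₁ →
        (∀ s, u s = ∑ j : Fin (w + 1), s ^ (j : ℕ) • c j) →
        (∀ q : ℝ[X], q.natDegree ≤ w →
          (∫ σ in t₀..t₁, (⟪deriv u σ, e⟫ + ⟪A (u σ), e⟫) * q.eval σ)
            + ⟪u t₀ - v, e⟫ * q.eval t₀ = 0) →
        (∀ σ ∈ Set.Icc t₀ t₁,
          (1 + lam * (t₁ - t₀)) * |⟪u σ, e⟫| ≤ C * |⟪v, e⟫| ∧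
          (1 + lam * (t₁ - t₀)) * |⟪deriv u σ, e⟫| ≤ C * lam * |⟪v, e⟫|) ∧
        (1 + lam * (t₁ - t₀)) * |⟪u t₀ - v, e⟫| ≤ C * lam * (t₁ - t₀) * |⟪v, e⟫| ∧
        (1 + δ * lam * (t₁ - t₀)) * |⟪u t₁, e⟫| ≤ |⟪v, e⟫| := by
  obtain ⟨C, δ, hC, hδ, hδ1, hstep⟩ := exists_dG_step_bound w
  refine ⟨C, δ, hC, hδ, hδ1, fun V _ _ A e v lam t₀ t₁ c u hA he hlam ht hu heq => ?_⟩
  set k := t₁ - t₀ with hk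
  have hk0 : 0 < k := sub_pos.2 ht
  set P₀ : ℝ[X] := ∑ j : Fin (w + 1), monomial (j : ℕ) ⟪c j, e⟫ with hP₀
  have hP₀deg : P₀.natDegree ≤ w := natDegree_sum_le_of_forall_le _ _ fun j _ =>
    (natDegree_monomial_le _).trans (Nat.lt_succ_iff.1 j.2)
  have hue : ∀ s, ⟪u s, e⟫ = P₀.eval s := fun s => by
    rw [hu, hP₀, sum_inner, eval_finsetSum]
    exact Finset.sum_congr rfl fun j _ => by
      rw [eval_monomial, real_inner_smul_left, mul_comm]
  have hud : Differentiable ℝ u := by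
    rw [funext hu]
    fun_prop
  have hu'e : ∀ s, ⟪deriv u s, e⟫ = P₀.derivative.eval s := fun s => by
    have h1 := (hud s).hasDerivAt.inner ℝ (hasDerivAt_const s e)
    simp only [inner_zero_right, zero_add, hue] at h1
    exact h1.unique (P₀.hasDerivAt s)
  have hAu : ∀ s, ⟪A (u s), e⟫ = lam * P₀.eval s := fun s => by
    rw [hA, he, inner_smul_right, hue]
  set ℓ : ℝ[X] := Polynomial.C t₀ + Polynomial.C k * X with hℓ
  have hℓeval : ∀ s, ℓ.eval s = t₀ + k * s := fun s => by simp [hℓ]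
  set p : ℝ[X] := P₀.comp ℓ with hp
  have hpeval : ∀ s, p.eval s = P₀.eval (t₀ + k * s) := fun s => by
    rw [hp, eval_comp, hℓeval]
  have hp'eval : ∀ s, p.derivative.eval s = k * P₀.derivative.eval (t₀ + k * s) := fun s => by
    rw [hp, derivative_comp, eval_mul, eval_comp, hℓeval]
    simp [hℓ]
  have hpdeg : p.natDegree ≤ w := by
    have : ℓ.natDegree ≤ 1 := by
      rw [hℓ]
      compute_degree
    calc p.natDegree ≤ P₀.natDegree * ℓ.natDegree := natDegree_comp_le
      _ ≤ w * 1 := Nat.mul_le_mul hP₀deg this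
      _ = w := mul_one w
  obtain ⟨hsup, hjump, hend⟩ := hstep (lam * k) ⟪v, e⟫ p (by positivity) hpdeg (by
    intro q hq
    set ℓ' : ℝ[X] := Polynomial.C k⁻¹ * (X - Polynomial.C t₀) with hℓ'
    have hℓ'deg : ℓ'.natDegree ≤ 1 := by
      rw [hℓ']
      compute_degree
    have h1 := heq (q.comp ℓ') (calc
      (q.comp ℓ').natDegree ≤ q.natDegree * ℓ'.natDegree := natDegree_comp_le
      _ ≤ w * 1 := Nat.mul_le_mul hq hℓ'deg
      _ = w := mul_one w)
    have hcomp : ∀ s, (q.comp ℓ').eval (t₀ + k * s) = q.eval s := fun s => by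
      rw [eval_comp]
      congr 1
      simp only [hℓ', eval_mul, eval_C, eval_sub, eval_X]
      field_simp
      ring
    have h2 := intervalIntegral.mul_integral_comp_add_mul (a := (0 : ℝ)) (b := 1)
      (f := fun σ => (P₀.derivative.eval σ + lam * P₀.eval σ) * (q.comp ℓ').eval σ) (c := k) (d := t₀)
    simp only [hcomp, mul_zero, add_zero, mul_one] at h2
    have hend : t₀ + k = t₁ := by rw [hk]; ring
    have hstart := hcomp 0
    rw [mul_zero, add_zero] at hstart
    simp only [hu'e, hAu, inner_sub_left, hue, hstart] at h1
    rw [hend, ← intervalIntegral.integral_const_mul] at h2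
    rw [← h2] at h1
    refine Eq.trans ?_ h1
    congr 1
    · congr 1
      funext x
      rw [hpeval, hp'eval]
      ring
    · rw [hpeval, mul_zero, add_zero])
  refine ⟨fun σ hσ => ?_, ?_, ?_⟩
  · have hs : (σ - t₀) / k ∈ Set.Icc (0 : ℝ) 1 :=
      ⟨div_nonneg (sub_nonneg.2 hσ.1) hk0.le, (div_le_one hk0).2 (by linarith [hσ.2])⟩
    have hσ' : t₀ + k * ((σ - t₀) / k) = σ := by field_simp; ring
    obtain ⟨h1, h2⟩ := hsup _ hs
    rw [hpeval, hσ'] at h1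
    rw [hp'eval, hσ', abs_mul, abs_of_pos hk0] at h2
    rw [hue, hu'e]
    refine ⟨h1, le_of_mul_le_mul_left ?_ hk0⟩
    linarith
  · rw [hpeval, mul_zero, add_zero] at hjump
    rw [inner_sub_left, hue]
    linarith
  · rw [hpeval, mul_one, show t₀ + k = t₁ by rw [hk]; ring] at hend
    rw [hue, mul_assoc]
    exact hend

theorem OrthonormalBasis.norm_le_of_abs_inner_le {ι V : Type*} [Fintype ι] [NormedAddCommGroup V]
    [InnerProductSpace ℝ V] (b : OrthonormalBasis ι ℝ V) {K : ℝ} (hK : 0 ≤ K) {x y : V}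
    (h : ∀ i, |⟪x, b i⟫| ≤ K * |⟪y, b i⟫|) : ‖x‖ ≤ K * ‖y‖ := by
  refine le_of_pow_le_pow_left₀ two_ne_zero (by positivity) ?_
  rw [mul_pow, ← b.sum_sq_norm_inner_left x, ← b.sum_sq_norm_inner_left y, Finset.mul_sum]
  refine Finset.sum_le_sum fun i _ => ?_
  rw [← mul_pow]
  exact pow_le_pow_left₀ (norm_nonneg _) (h i) 2

/-- **Discrete smoothing estimate (dG(w) analogue of Theorem 4.1).**
There is a constant `C` depending only on `w, κ, c, β` such that for the dG(w) approximation
`u_τ` with `f = 0` and initial value `u₀ ∈ V` one has, for every `m = 1, …, M`,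
`sup_{I_m} ‖∂_t u_τ‖ + sup_{I_m} ‖A u_τ‖ + τ_m⁻¹ ‖[u_τ]_{m-1}‖ ≤ (C / t_m) ‖u₀‖`,
where `[u_τ]_0 = u_{τ,0}^+ - u₀`. -/
theorem stmt6 :
    ∀ (w : ℕ) (κ c β : ℝ), 1 ≤ κ → 0 < c → 0 < β →
    ∃ C : ℝ, 0 < C ∧
      ∀ (V : Type) [NormedAddCommGroup V] [InnerProductSpace ℝ V] [FiniteDimensional ℝ V],
      ∀ (A : V →ₗ[ℝ] V) (lam0 : ℝ), 0 < lam0 →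
        (∀ v w' : V, ⟪A v, w'⟫ = ⟪v, A w'⟫) →
        (∀ v : V, lam0 * ‖v‖ ^ 2 ≤ ⟪A v, v⟫) →
      ∀ (T : ℝ) (M : ℕ) (t : ℕ → ℝ) (τ τmin : ℝ),
        0 < T → 1 ≤ M → t 0 = 0 → t M = T →
        (∀ m, m < M → t m < t (m + 1)) →
        (∀ m, 1 ≤ m → m ≤ M → t m - t (m - 1) ≤ τ) →
        (∃ m, 1 ≤ m ∧ m ≤ M ∧ τ = t m - t (m - 1)) →
        (∀ m, 1 ≤ m → m ≤ M → τmin ≤ t m - t (m - 1)) →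
        (∃ m, 1 ≤ m ∧ m ≤ M ∧ τmin = t m - t (m - 1)) →
        τ ≤ T / 4 →
        (∀ m, 1 ≤ m → m + 1 ≤ M →
          κ⁻¹ ≤ (t m - t (m - 1)) / (t (m + 1) - t m) ∧
            (t m - t (m - 1)) / (t (m + 1) - t m) ≤ κ) →
        c * τ ^ β ≤ τmin →
      ∀ (u₀ : V) (U : ℕ → ℝ → V), PPoly w M U →
        DGeq w A M t (fun _ => (0 : V)) u₀ U →
      ∀ m, 1 ≤ m → m ≤ M →
        (⨆ σ : Set.Ioc (t (m - 1)) (t m), ‖deriv (U m) (σ : ℝ)‖)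
          + (⨆ σ : Set.Ioc (t (m - 1)) (t m), ‖A (U m (σ : ℝ))‖)
          + (t m - t (m - 1))⁻¹ *
              ‖U m (t (m - 1)) - (if m = 1 then u₀ else U (m - 1) (t (m - 1)))‖
        ≤ C / t m * ‖u₀‖ := by
  intro w κ c β _ _ _
  obtain ⟨C, δ, hC, hδ, hδ1, hstep⟩ := exists_dG_eigenvector_step_bound w
  refine ⟨3 * (C / δ), by positivity, ?_⟩
  intro V _ _ _ A lam0 hlam0 hA hcoer T M t τ τmin _ _ ht0 _ hmono _ _ _ _ _ _ _ u₀ U hU hDG m hm hmM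
  have hsymm : A.IsSymmetric := hA
  let b := hsymm.eigenvectorBasis rfl
  let lam := hsymm.eigenvalues rfl
  have hb : ∀ i, A (b i) = lam i • b i := hsymm.apply_eigenvectorBasis rfl
  have hlam : ∀ i, 0 < lam i := fun i => by
    have h := hcoer (b i)
    rw [hb, real_inner_smul_left, real_inner_self_eq_norm_sq, b.orthonormal.1 i] at h
    linarith
  have htm : ∀ k, 1 ≤ k → k ≤ M → t (k - 1) < t k := fun k hk hkM => by
    have h := hmono (k - 1) (by omega)
    rwa [Nat.sub_add_cancel hk] at h
  have htnn : ∀ k, k ≤ M → 0 ≤ t k := by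
    intro k
    induction k with
    | zero => intro _; rw [ht0]
    | succ k ih => intro hk; exact (ih (by omega)).trans (hmono k (by omega)).le
  set prev : ℕ → V := fun k => if k = 1 then u₀ else U (k - 1) (t (k - 1)) with hprev
  have hloc := fun (k : ℕ) (hk : 1 ≤ k) (hkM : k ≤ M) (i : Fin (Module.finrank ℝ V)) =>
    hstep V A (b i) (prev k) (lam i) (t (k - 1)) (t k) (hU k hk hkM).choose (U k) hA (hb i)
      (hlam i) (htm k hk hkM) (hU k hk hkM).choose_spec
      (fun q hq => hDG.local_eq hk hkM hq (b i))
  have hdecay : ∀ i, ∀ k, k + 1 ≤ M →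
      (1 + δ * lam i * t k) * |⟪prev (k + 1), b i⟫| ≤ |⟪u₀, b i⟫| := by
    intro i k
    induction k with
    | zero => intro _; simp [hprev, ht0]
    | succ k ih =>
      intro hk
      have h1 := ih (by omega)
      have h2 := (hloc (k + 1) (by omega) (by omega) i).2.2
      have h3 : prev (k + 1 + 1) = U (k + 1) (t (k + 1)) := by simp [hprev]
      simp only [Nat.add_sub_cancel] at h2
      rw [h3]
      have hpos : 0 < δ * lam i := mul_pos hδ (hlam i)
      have h4 : 0 ≤ t k := htnn k (by omega)
      have h5 : t k < t (k + 1) := hmono k (by omega)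
      refine le_trans ?_ h1
      refine le_trans ?_ (mul_le_mul_of_nonneg_left h2 (by positivity))
      rw [← mul_assoc]
      refine mul_le_mul_of_nonneg_right ?_ (abs_nonneg _)
      have h6 : 0 ≤ δ * lam i * t k * (δ * lam i * (t (k + 1) - t k)) :=
        mul_nonneg (by positivity) (mul_nonneg hpos.le (by linarith))
      linarith
  have htpos : 0 < t m := (htnn (m - 1) (by omega)).trans_lt (htm m hm hmM)
  have hk : 0 < t m - t (m - 1) := sub_pos.2 (htm m hm hmM)
  -- combining the decay up to `t (m - 1)` with the damping on the last interval
  have hcombine : ∀ i (x y : ℝ), 0 ≤ x → 0 ≤ y →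
      (1 + lam i * (t m - t (m - 1))) * x ≤ C * y * |⟪prev m, b i⟫| →
      lam i * x ≤ C / δ / t m * y * |⟪u₀, b i⟫| := by
    intro i x y hx hy h
    have h1 := hdecay i (m - 1) (by omega)
    rw [Nat.sub_add_cancel hm] at h1
    have hl := hlam i
    have hpos : 0 < δ * lam i := mul_pos hδ hl
    have h4 : 0 ≤ t (m - 1) := htnn (m - 1) (by omega)
    have h5 : δ * lam i * t m * x ≤ C * y * |⟪u₀, b i⟫| := by
      calc δ * lam i * t m * x
          ≤ (1 + δ * lam i * t (m - 1)) * ((1 + lam i * (t m - t (m - 1))) * x) := by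
            rw [← mul_assoc]
            refine mul_le_mul_of_nonneg_right ?_ hx
            have h6 : δ * (lam i * (t m - t (m - 1))) ≤ 1 * (lam i * (t m - t (m - 1))) := by
              gcongr
            have h7 : 0 ≤ δ * lam i * t (m - 1) * (lam i * (t m - t (m - 1))) := by positivity
            linarith
        _ ≤ (1 + δ * lam i * t (m - 1)) * (C * y * |⟪prev m, b i⟫|) := by gcongr
        _ = C * y * ((1 + δ * lam i * t (m - 1)) * |⟪prev m, b i⟫|) := by ring
        _ ≤ C * y * |⟪u₀, b i⟫| := by gcongr
    rw [show C / δ / t m * y * |⟪u₀, b i⟫| = C * y * |⟪u₀, b i⟫| / (δ * t m) by field_simp,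
      le_div_iff₀ (by positivity)]
    linarith
  have hK : 0 ≤ C / δ / t m := by positivity
  have hderiv : ∀ σ ∈ Set.Icc (t (m - 1)) (t m), ‖deriv (U m) σ‖ ≤ C / δ / t m * ‖u₀‖ := by
    refine fun σ hσ => b.norm_le_of_abs_inner_le hK fun i => ?_
    have h := hcombine i _ (lam i) (abs_nonneg _) (hlam i).le ((hloc m hm hmM i).1 σ hσ).2
    exact le_of_mul_le_mul_left (by linarith) (hlam i)
  have hAU : ∀ σ ∈ Set.Icc (t (m - 1)) (t m), ‖A (U m σ)‖ ≤ C / δ / t m * ‖u₀‖ := by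
    refine fun σ hσ => b.norm_le_of_abs_inner_le hK fun i => ?_
    have h := hcombine i _ 1 (abs_nonneg _) zero_le_one
      (by rw [mul_one]; exact ((hloc m hm hmM i).1 σ hσ).1)
    rw [hA, hb, inner_smul_right, abs_mul, abs_of_pos (hlam i)]
    linarith
  have hjump : ‖U m (t (m - 1)) - prev m‖ ≤ C / δ / t m * (t m - t (m - 1)) * ‖u₀‖ := by
    refine b.norm_le_of_abs_inner_le (by positivity) fun i => ?_
    have h := hcombine i _ (lam i * (t m - t (m - 1))) (abs_nonneg _)
      (mul_nonneg (hlam i).le hk.le) (by rw [← mul_assoc]; exact (hloc m hm hmM i).2.1)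
    exact le_of_mul_le_mul_left (by linarith) (hlam i)
  have hR : 0 ≤ C / δ / t m * ‖u₀‖ := by positivity
  have h1 := Real.iSup_le (fun σ : Set.Ioc (t (m - 1)) (t m) =>
    hderiv σ (Set.Ioc_subset_Icc_self σ.2)) hR
  have h2 := Real.iSup_le (fun σ : Set.Ioc (t (m - 1)) (t m) =>
    hAU σ (Set.Ioc_subset_Icc_self σ.2)) hR
  have h3 : (t m - t (m - 1))⁻¹ * ‖U m (t (m - 1)) - prev m‖ ≤ C / δ / t m * ‖u₀‖ := by
    rw [inv_mul_le_iff₀ hk]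
    linarith
  calc _ ≤ C / δ / t m * ‖u₀‖ + C / δ / t m * ‖u₀‖ + C / δ / t m * ‖u₀‖ :=
        add_le_add (add_le_add h1 h2) h3
    _ = 3 * (C / δ) / t m * ‖u₀‖ := by ring
end

section
/- Existence of a regularized Dirac delta in time reproducing polynomials, including at the right endpoint: for every integer w ≥ 0 there is a constant C = C(w) > 0 such that for all real numbers a < b and every point t̃ ∈ (a, b] there exists a function θ : ℝ → ℝ of class C¹ whose support is a compact subset of the open interval (a, b), such that ∫_a^b θ(t)·q(t) dt = q(t̃) for every real polynomial q of degree at most w, and moreover ∫_a^b |θ(t)| dt ≤ C and sup_t |θ(t)| ≤ C·(b − a)⁻¹. -/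
open Polynomial in
/-- A weighted `L²` pairing on polynomials of degree less than `n` represents every functional. -/
theorem exists_polynomial_weighted_integral_eq {φ : ℝ → ℝ} (hφ : Continuous φ)
    (hφ0 : ∀ t, 0 ≤ φ t) {S : Set ℝ} (hS : S.Infinite) (hSI : S ⊆ Set.Icc 0 1)
    (hφS : ∀ t ∈ S, 0 < φ t) (n : ℕ) (l : Module.Dual ℝ (degreeLT ℝ n)) :
    ∃ p : ℝ[X], ∀ q : degreeLT ℝ n,
      ∫ t in (0 : ℝ)..1, φ t * p.eval t * (q : ℝ[X]).eval t = l q := by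
  have hint (p q : ℝ[X]) : IntervalIntegrable (fun t => φ t * p.eval t * q.eval t)
      MeasureTheory.volume 0 1 :=
    ((hφ.mul p.continuous).mul q.continuous).intervalIntegrable 0 1
  let T : degreeLT ℝ n →ₗ[ℝ] Module.Dual ℝ (degreeLT ℝ n) :=
    LinearMap.mk₂ ℝ
      (fun p q => ∫ t in (0 : ℝ)..1, φ t * (p : ℝ[X]).eval t * (q : ℝ[X]).eval t)
      (fun p p' q => by
        rw [← intervalIntegral.integral_add (hint _ _) (hint _ _)]
        congr 1 with t
        simp only [Submodule.coe_add, eval_add]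
        ring)
      (fun c p q => by
        rw [smul_eq_mul, ← intervalIntegral.integral_const_mul]
        congr 1 with t
        simp only [Submodule.coe_smul, eval_smul, smul_eq_mul]
        ring)
      (fun p q q' => by
        rw [← intervalIntegral.integral_add (hint _ _) (hint _ _)]
        congr 1 with t
        simp only [Submodule.coe_add, eval_add]
        ring)
      (fun c p q => by
        rw [smul_eq_mul, ← intervalIntegral.integral_const_mul]
        congr 1 with t
        simp only [Submodule.coe_smul, eval_smul, smul_eq_mul]
        ring)
  have hT : Function.Injective T := by
    rw [injective_iff_map_eq_zero]
    intro p hp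
    have h0 : ∫ t in (0 : ℝ)..1, φ t * (p : ℝ[X]).eval t * (p : ℝ[X]).eval t = 0 :=
      DFunLike.congr_fun hp p
    refine Subtype.ext (eq_zero_of_infinite_isRoot _ (hS.mono fun c hc => ?_))
    by_contra hcp
    refine (intervalIntegral.integral_pos zero_lt_one
      ((hφ.mul p.1.continuous).mul p.1.continuous).continuousOn
      (fun t _ => ?_) ⟨c, hSI hc, ?_⟩).ne' h0
    · rw [mul_assoc]
      exact mul_nonneg (hφ0 t) (mul_self_nonneg _)
    · rw [mul_assoc]
      exact mul_pos (hφS c hc) (mul_self_pos.2 hcp)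
  have : Module.Finite ℝ (degreeLT ℝ n) :=
    Module.Finite.equiv (degreeLTEquiv ℝ n).symm
  obtain ⟨p, hp⟩ := (LinearMap.injective_iff_surjective_of_finrank_eq_finrank
    Subspace.dual_finrank_eq.symm).1 hT l
  exact ⟨p, fun q => DFunLike.congr_fun hp q⟩

open Polynomial in
/-- A family of regularized delta functions on the unit interval, uniformly bounded in the
evaluation point. -/
theorem exists_unit_interval_regularized_delta (w : ℕ) :
    ∃ C : ℝ, 0 < C ∧ ∀ x ∈ Set.Icc (0 : ℝ) 1, ∃ Θ : ℝ → ℝ,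
      ContDiff ℝ 1 Θ ∧ tsupport Θ ⊆ Set.Ioo 0 1 ∧
      (∀ q : ℝ[X], q.natDegree ≤ w → ∫ t in (0 : ℝ)..1, Θ t * q.eval t = q.eval x) ∧
      ∀ t, |Θ t| ≤ C := by
  let φ : ContDiffBump (1 / 2 : ℝ) := ⟨1 / 8, 1 / 4, by norm_num, by norm_num⟩
  have hsupp : tsupport φ ⊆ Set.Ioo 0 1 := by
    rw [φ.tsupport_eq, Real.closedBall_eq_Icc]
    exact Set.Icc_subset_Ioo (by norm_num [φ]) (by norm_num [φ])
  have hdual (i : ℕ) : ∃ p : ℝ[X], ∀ q : degreeLT ℝ (w + 1),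
      ∫ t in (0 : ℝ)..1, φ t * p.eval t * (q : ℝ[X]).eval t = (q : ℝ[X]).coeff i := by
    refine exists_polynomial_weighted_integral_eq φ.continuous (fun t => φ.nonneg)
      (S := Metric.ball (1 / 2) φ.rOut) ?_ ?_ (fun t ht => φ.pos_of_mem_ball ht) (w + 1)
      ((lcoeff ℝ i).comp (degreeLT ℝ (w + 1)).subtype)
    · rw [Real.ball_eq_Ioo]
      exact Set.Ioo_infinite (by norm_num [φ])
    · rw [← φ.support_eq]
      exact (subset_tsupport _).trans (hsupp.trans Set.Ioo_subset_Icc_self)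
  choose p hp using hdual
  let Θ (x t : ℝ) : ℝ := φ t * ∑ i ∈ Finset.range (w + 1), x ^ i * (p i).eval t
  have hcont : Continuous (fun z : ℝ × ℝ => Θ z.1 z.2) := by
    refine (φ.continuous.comp continuous_snd).mul (continuous_finsetSum _ fun i _ => ?_)
    exact (continuous_fst.pow i).mul ((p i).continuous.comp continuous_snd)
  obtain ⟨C, hC⟩ := ((isCompact_Icc (a := (0 : ℝ)) (b := 1)).prod
    (isCompact_Icc (a := (0 : ℝ)) (b := 1))).exists_bound_of_continuousOn hcont.continuousOn
  refine ⟨max C 1, by positivity, fun x hx => ⟨Θ x, ?_, ?_, ?_, ?_⟩⟩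
  · refine φ.contDiff.mul (ContDiff.sum fun i _ => contDiff_const.mul ?_)
    simpa using (p i).contDiff_aeval (𝕜 := ℝ) 1
  · exact (tsupport_mul_subset_left).trans hsupp
  · intro q hq
    have hmem : q ∈ degreeLT ℝ (w + 1) :=
      mem_degreeLT.2 (degree_lt_iff_coeff_zero _ _ |>.2 fun m hm =>
        coeff_eq_zero_of_natDegree_lt (by omega))
    have hexp : ∀ t, Θ x t * q.eval t =
        ∑ i ∈ Finset.range (w + 1), x ^ i * (φ t * (p i).eval t * q.eval t) := fun t => by
      simp only [Θ, Finset.mul_sum, Finset.sum_mul]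
      exact Finset.sum_congr rfl fun i _ => by ring
    simp only [hexp]
    have hint : ∀ i ∈ Finset.range (w + 1), IntervalIntegrable
        (fun t => x ^ i * (φ t * (p i).eval t * q.eval t)) MeasureTheory.volume 0 1 :=
      fun i _ => (continuous_const.mul
        ((φ.continuous.mul (p i).continuous).mul q.continuous)).intervalIntegrable 0 1
    rw [intervalIntegral.integral_finsetSum hint, eval_eq_sum_range' (Nat.lt_succ_of_le hq)]
    refine Finset.sum_congr rfl fun i _ => ?_
    rw [intervalIntegral.integral_const_mul, hp i ⟨q, hmem⟩, mul_comm]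
  · intro t
    by_cases ht : t ∈ Set.Icc (0 : ℝ) 1
    · exact (hC (x, t) ⟨hx, ht⟩).trans (le_max_left _ _)
    · have : φ t = 0 := image_eq_zero_of_notMem_tsupport fun h =>
        ht (Set.Ioo_subset_Icc_self (hsupp h))
      simp [Θ, this]


/-- **Regularized Dirac delta in time reproducing polynomials, including at the right
endpoint** (properties (6.2)/(eq:delta_t)).  For every polynomial degree `w` there is a
constant `C = C(w) > 0` such that for all `a < b` and every `t̃ ∈ (a, b]` there exists a `C¹`
function `θ : ℝ → ℝ`, compactly supported in the open interval `(a, b)`, with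
`∫_a^b θ q = q(t̃)` for every real polynomial `q` of degree at most `w`,
`∫_a^b |θ| ≤ C` and `sup |θ| ≤ C (b - a)⁻¹`. -/
theorem stmt12 (w : ℕ) :
    ∃ C : ℝ, 0 < C ∧
      ∀ a b : ℝ, a < b → ∀ ttil ∈ Set.Ioc a b,
        ∃ θ : ℝ → ℝ,
          ContDiff ℝ 1 θ ∧
          HasCompactSupport θ ∧
          tsupport θ ⊆ Set.Ioo a b ∧
          (∀ q : Polynomial ℝ, q.natDegree ≤ w →
            ∫ s in a..b, θ s * q.eval s = q.eval ttil) ∧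
          (∫ s in a..b, |θ s|) ≤ C ∧
          ∀ s : ℝ, |θ s| ≤ C * (b - a)⁻¹ := by
  obtain ⟨C, hC, H⟩ := exists_unit_interval_regularized_delta w
  refine ⟨C, hC, fun a b hab x hx => ?_⟩
  have hL : 0 < b - a := sub_pos.2 hab
  obtain ⟨Θ, hsmooth, hsupp, hrep, hbound⟩ := H ((x - a) / (b - a))
    ⟨div_nonneg (sub_nonneg.2 hx.1.le) hL.le, (div_le_one hL).2 (by linarith [hx.2])⟩
  let g : ℝ → ℝ := fun s => (s - a) / (b - a)
  have hg : Continuous g := by fun_prop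
  have hts : tsupport (fun s => (b - a)⁻¹ * Θ (g s)) ⊆ Set.Ioo a b := by
    intro s hs
    have h1 : g s ∈ Set.Ioo (0 : ℝ) 1 :=
      hsupp (tsupport_comp_subset_preimage Θ hg (tsupport_mul_subset_right hs))
    have h2 := (div_pos_iff_of_pos_right hL).1 h1.1
    have h3 := (div_lt_one hL).1 h1.2
    exact ⟨by linarith, by linarith⟩
  have hbd : ∀ s, |(b - a)⁻¹ * Θ (g s)| ≤ C * (b - a)⁻¹ := fun s => by
    rw [abs_mul, abs_of_pos (inv_pos.2 hL), mul_comm]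
    exact mul_le_mul_of_nonneg_right (hbound _) (inv_pos.2 hL).le
  refine ⟨fun s => (b - a)⁻¹ * Θ (g s), ?_, ?_, hts, ?_, ?_, hbd⟩
  · exact contDiff_const.mul (hsmooth.comp ((contDiff_id.sub contDiff_const).div_const _))
  · exact isCompact_Icc.of_isClosed_subset (isClosed_tsupport _)
      (hts.trans Set.Ioo_subset_Icc_self)
  · intro q hq
    let r : Polynomial ℝ := q.comp (Polynomial.C (b - a) * Polynomial.X + Polynomial.C a)
    have hr : r.natDegree ≤ w := by
      refine Polynomial.natDegree_comp_le.trans ?_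
      refine (Nat.mul_le_mul_left _ Polynomial.natDegree_linear_le).trans ?_
      rwa [mul_one]
    have hre : ∀ t, r.eval t = q.eval ((b - a) * t + a) := fun t => by simp [r]
    have hsub := intervalIntegral.mul_integral_comp_mul_add (a := 0) (b := 1)
      (f := fun s => (b - a)⁻¹ * Θ (g s) * q.eval s) (b - a) a
    rw [mul_zero, zero_add, mul_one, sub_add_cancel] at hsub
    rw [← hsub, ← intervalIntegral.integral_const_mul]
    have hx' : q.eval x = r.eval ((x - a) / (b - a)) := by
      rw [hre, mul_div_cancel₀ _ hL.ne', sub_add_cancel]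
    rw [hx', ← hrep r hr]
    congr 1 with t
    have hgt : g ((b - a) * t + a) = t := by
      simp only [g, add_sub_cancel_right]
      exact mul_div_cancel_left₀ t hL.ne'
    rw [hgt, hre, ← mul_assoc, ← mul_assoc, mul_inv_cancel₀ hL.ne', one_mul]
  · have h := intervalIntegral.norm_integral_le_of_norm_le_const (a := a) (b := b)
      (f := fun s => |(b - a)⁻¹ * Θ (g s)|) (C := C * (b - a)⁻¹) fun s _ => by
        simpa only [Real.norm_eq_abs, abs_abs] using hbd s
    rw [abs_of_pos hL, inv_mul_cancel_right₀ hL.ne'] at h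
    exact (le_abs_self _).trans h
end
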